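/- arXiv:1906.01694 — 3 statements merged into one kernel-verified Lean document; each statement's English description precedes it below -/
import Mathlib

section
/- Let U ⊆ ℝ² be a nonempty open set and let Γ_{ij}^k : U → ℝ (i,j,k ∈ {1,2}) be smooth Christoffel symbols, where torsion is allowed (Γ_{12}^k need not equal Γ_{21}^k). Define the symmetrized (torsion-free) Christoffel symbols ⁰Γ_{ij}^k := ½(Γ_{ij}^k + Γ_{ji}^k). Then every affine Killing vector field for Γ on U is also an affine Killing vector field for ⁰Γ on U. -/
open Real

/-- The partial derivative `∂f/∂x^i` of a function on `ℝ²` (points are `Fin 2 → ℝ`). -/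
noncomputable def pd (f : (Fin 2 → ℝ) → ℝ) (i : Fin 2) (p : Fin 2 → ℝ) : ℝ :=
  fderiv ℝ f p (Pi.single i 1)

/-- The affine Killing operator
`K^Γ_{ij}^k(v) = ∂_i∂_j v^k + v^l ∂_l Γ_{ij}^k − Γ_{ij}^l ∂_l v^k + Γ_{il}^k ∂_j v^l + Γ_{lj}^k ∂_i v^l`
(summation over `l`). -/
noncomputable def killingOp (Γ : Fin 2 → Fin 2 → Fin 2 → (Fin 2 → ℝ) → ℝ)
    (v : Fin 2 → (Fin 2 → ℝ) → ℝ) (i j k : Fin 2) (p : Fin 2 → ℝ) : ℝ :=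
  pd (fun q => pd (v k) j q) i p
    + (∑ l : Fin 2, v l p * pd (Γ i j k) l p)
    - (∑ l : Fin 2, Γ i j l p * pd (v k) l p)
    + (∑ l : Fin 2, Γ i l k p * pd (v l) j p)
    + (∑ l : Fin 2, Γ l j k p * pd (v l) i p)

/-- `v` is an affine Killing vector field for the connection `Γ` on `U`:
all eight affine Killing equations hold on `U`. -/
def IsAffineKilling (U : Set (Fin 2 → ℝ))
    (Γ : Fin 2 → Fin 2 → Fin 2 → (Fin 2 → ℝ) → ℝ)
    (v : Fin 2 → (Fin 2 → ℝ) → ℝ) : Prop :=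
  ∀ i j k : Fin 2, ∀ p ∈ U, killingOp Γ v i j k p = 0

/-- Partial derivatives of a `C²` function commute. -/
theorem pd_comm {f : (Fin 2 → ℝ) → ℝ} {p : Fin 2 → ℝ} (hf : ContDiffAt ℝ 2 f p) (i j : Fin 2) :
    pd (fun q => pd f j q) i p = pd (fun q => pd f i q) j p := by
  have hd : DifferentiableAt ℝ (fderiv ℝ f) p :=
    (hf.fderiv_right (m := 1) (by norm_num)).differentiableAt (by norm_num)
  have key (a b : Fin 2) :
      pd (fun q => pd f a q) b p = fderiv ℝ (fderiv ℝ f) p (Pi.single b 1) (Pi.single a 1) := by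
    unfold pd
    rw [fderiv_clm_apply hd (differentiableAt_const _)]
    simp
  rw [key, key]
  exact (hf.isSymmSndFDerivAt (by simp)).eq _ _

/-- The partial derivative of the average of two functions is the average of the partial
derivatives. -/
theorem pd_average {f g : (Fin 2 → ℝ) → ℝ} {p : Fin 2 → ℝ} (hf : DifferentiableAt ℝ f p)
    (hg : DifferentiableAt ℝ g p) (i : Fin 2) :
    pd (fun q => (f q + g q) / 2) i p = (pd f i p + pd g i p) / 2 := by
  unfold pd
  have h := ((hf.hasFDerivAt.add hg.hasFDerivAt).mul_const (2⁻¹ : ℝ)).fderiv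
  simp only [Pi.add_apply] at h
  simp only [div_eq_mul_inv, h]
  simp [mul_comm, mul_add]

/-- The Killing operator of the symmetrized connection is the symmetrization of the Killing
operator. -/
theorem killingOp_symmetrization {Γ : Fin 2 → Fin 2 → Fin 2 → (Fin 2 → ℝ) → ℝ}
    {v : Fin 2 → (Fin 2 → ℝ) → ℝ} {p : Fin 2 → ℝ}
    (hΓ : ∀ i j k : Fin 2, DifferentiableAt ℝ (Γ i j k) p)
    (hv : ∀ i : Fin 2, ContDiffAt ℝ 2 (v i) p) (i j k : Fin 2) :
    killingOp (fun i j k p => (Γ i j k p + Γ j i k p) / 2) v i j k p =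
      (killingOp Γ v i j k p + killingOp Γ v j i k p) / 2 := by
  simp only [killingOp, Fin.sum_univ_two, pd_average (hΓ i j k) (hΓ j i k),
    pd_comm (hv k) j i]
  ring

theorem stmt0 (U : Set (Fin 2 → ℝ)) (hUopen : IsOpen U) (hUne : U.Nonempty)
    (Γ : Fin 2 → Fin 2 → Fin 2 → (Fin 2 → ℝ) → ℝ)
    (hΓ : ∀ i j k : Fin 2, ContDiffOn ℝ (⊤ : ℕ∞) (Γ i j k) U)
    (v : Fin 2 → (Fin 2 → ℝ) → ℝ)
    (hv : ∀ i : Fin 2, ContDiffOn ℝ (⊤ : ℕ∞) (v i) U)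
    (hK : IsAffineKilling U Γ v) :
    IsAffineKilling U (fun i j k p => (Γ i j k p + Γ j i k p) / 2) v := by
  intro i j k p hp
  have hU : U ∈ nhds p := hUopen.mem_nhds hp
  rw [killingOp_symmetrization
    (fun i j k => ((hΓ i j k).contDiffAt hU).differentiableAt (by simp))
    (fun i => ((hv i).contDiffAt hU).of_le (by exact WithTop.coe_le_coe.2 le_top)),
    hK i j k p hp, hK j i k p hp]
  norm_num
end

section
/- Let (T¹,T²) ∈ ℝ² with (T¹,T²) ≠ (0,0), and consider on ℝ² the connection with constant Christoffel symbols Γ_{12}¹ = T¹, Γ_{12}² = T², Γ_{21}¹ = −T¹, Γ_{21}² = −T², and all other Γ_{ij}^k = 0 (the model M₀⁶(T)). Then a smooth vector field X on ℝ² is an affine Killing vector field for this connection if and only if X lies in the ℝ-linear span of the four vector fields (1,0), (0,1), (x¹T¹, x¹T²), and (x²T¹, x²T²). -/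
open Real

theorem hasFDerivAt_affine (a b c : ℝ) (p : Fin 2 → ℝ) :
    HasFDerivAt (fun q : Fin 2 → ℝ => a + b * q 0 + c * q 1)
      (b • ContinuousLinearMap.proj (R := ℝ) (φ := fun _ : Fin 2 => ℝ) 0
        + c • ContinuousLinearMap.proj (R := ℝ) (φ := fun _ : Fin 2 => ℝ) 1) p :=
  (((hasFDerivAt_apply (𝕜 := ℝ) (F' := fun _ : Fin 2 => ℝ) 0 p).const_mul b).const_add a).add
    ((hasFDerivAt_apply (𝕜 := ℝ) (F' := fun _ : Fin 2 => ℝ) 1 p).const_mul c)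

theorem pd_affine (a b c : ℝ) (i : Fin 2) (p : Fin 2 → ℝ) :
    pd (fun q => a + b * q 0 + c * q 1) i p = ![b, c] i := by
  rw [pd, (hasFDerivAt_affine a b c p).fderiv]
  fin_cases i <;> simp

theorem pd_const (a : ℝ) (i : Fin 2) (p : Fin 2 → ℝ) : pd (fun _ => a) i p = 0 := by
  simp [pd]

theorem fderiv_eq_zero_of_pd {f : (Fin 2 → ℝ) → ℝ} {p : Fin 2 → ℝ}
    (h : ∀ i, pd f i p = 0) : fderiv ℝ f p = 0 := by
  apply ContinuousLinearMap.coe_injective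
  refine (Pi.basisFun ℝ (Fin 2)).ext fun i => ?_
  simpa [pd] using h i

theorem eq_of_pd_eq_zero {f : (Fin 2 → ℝ) → ℝ} (hf : Differentiable ℝ f)
    (h : ∀ i p, pd f i p = 0) (p q : Fin 2 → ℝ) : f p = f q :=
  is_const_of_fderiv_eq_zero hf (fun x => fderiv_eq_zero_of_pd fun i => h i x) p q

theorem differentiable_pd {f : (Fin 2 → ℝ) → ℝ} (hf : ContDiff ℝ 2 f) (i : Fin 2) :
    Differentiable ℝ (pd f i) :=
  ((hf.fderiv_right (m := 1) (by norm_num)).differentiable (by norm_num)).clm_apply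
    (differentiable_const _)

theorem pd_pd_eq {f : (Fin 2 → ℝ) → ℝ} (hf : ContDiff ℝ 2 f) (i j : Fin 2) (p : Fin 2 → ℝ) :
    pd (fun q => pd f j q) i p
      = fderiv ℝ (fderiv ℝ f) p (Pi.single i 1) (Pi.single j 1) := by
  have hd : DifferentiableAt ℝ (fderiv ℝ f) p :=
    ((hf.fderiv_right (m := 1) (by norm_num)).differentiable (by norm_num)) p
  change fderiv ℝ (fun q => fderiv ℝ f q (Pi.single j 1)) p (Pi.single i 1) = _
  rw [fderiv_clm_apply hd (differentiableAt_const _)]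
  simp

theorem pd_pd_comm {f : (Fin 2 → ℝ) → ℝ} (hf : ContDiff ℝ 2 f) (i j : Fin 2) (p : Fin 2 → ℝ) :
    pd (fun q => pd f j q) i p = pd (fun q => pd f i q) j p := by
  rw [pd_pd_eq hf, pd_pd_eq hf]
  exact (hf.contDiffAt.isSymmSndFDerivAt (by simp)) _ _

/-- A function on the plane whose second partial derivatives all vanish is affine. -/
theorem eq_affine_of_pd_pd_eq_zero {f : (Fin 2 → ℝ) → ℝ} (hf : ContDiff ℝ 2 f)
    (h : ∀ i j p, pd (fun q => pd f j q) i p = 0) (p : Fin 2 → ℝ) :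
    f p = f 0 + pd f 0 0 * p 0 + pd f 1 0 * p 1 := by
  have hc (j p) : pd f j p = pd f j 0 :=
    eq_of_pd_eq_zero (differentiable_pd hf j) (fun i q => h i j q) p 0
  have hd : Differentiable ℝ f := hf.differentiable (by norm_num)
  have ha (q) := hasFDerivAt_affine (f 0) (pd f 0 0) (pd f 1 0) q
  have := eq_of_pd_eq_zero
    (f := fun q => f q - (f 0 + pd f 0 0 * q 0 + pd f 1 0 * q 1))
    (fun q => (hd q).sub (ha q).differentiableAt)
    (fun i q => by
      have e := ((hd q).hasFDerivAt.sub (ha q)).fderiv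
      have hi := hc i q
      change fderiv ℝ (f - fun q => f 0 + pd f 0 0 * q 0 + pd f 1 0 * q 1) q _ = 0
      rw [e, sub_apply]
      change pd f i q - _ = 0
      rw [hi]
      fin_cases i <;> simp) p 0
  simp at this
  linarith

/-- The Killing equations of the model `M₀⁶(T)`, with the sums expanded. -/
theorem isAffineKilling_iff (T1 T2 : ℝ) (v : Fin 2 → (Fin 2 → ℝ) → ℝ) :
    IsAffineKilling Set.univ
      (fun i j k => fun _ : Fin 2 → ℝ =>
        ![![![(0 : ℝ), 0], ![T1, T2]], ![![-T1, -T2], ![0, 0]]] i j k) v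
    ↔ ∀ k p, pd (fun q => pd (v k) 0 q) 0 p = 0 ∧ pd (fun q => pd (v k) 1 q) 1 p = 0 ∧
        pd (fun q => pd (v k) 1 q) 0 p - (T1 * pd (v k) 0 p + T2 * pd (v k) 1 p)
          + ![T1, T2] k * (pd (v 0) 0 p + pd (v 1) 1 p) = 0 ∧
        pd (fun q => pd (v k) 0 q) 1 p + (T1 * pd (v k) 0 p + T2 * pd (v k) 1 p)
          - ![T1, T2] k * (pd (v 0) 0 p + pd (v 1) 1 p) = 0 := by
  simp only [IsAffineKilling, killingOp, pd_const, Fin.sum_univ_two, Set.mem_univ, true_imp_iff]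
  constructor
  · intro h k p
    have h00 := h 0 0 k p
    have h01 := h 0 1 k p
    have h10 := h 1 0 k p
    have h11 := h 1 1 k p
    fin_cases k <;> simp at h00 h01 h10 h11 ⊢ <;>
      refine ⟨?_, ?_, ?_, ?_⟩ <;> linarith
  · intro h i j k p
    obtain ⟨h00, h11, h01, h10⟩ := h k p
    fin_cases k <;> fin_cases i <;> fin_cases j <;> simp at h00 h01 h10 h11 ⊢ <;> linarith

theorem exists_mul_eq_of_mul_eq_mul {s t x y : ℝ} (hT : (s, t) ≠ (0, 0)) (h : t * x = s * y) :
    ∃ c, x = c * s ∧ y = c * t := by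
  by_cases hs : s = 0
  · have ht : t ≠ 0 := fun ht => hT (by rw [hs, ht])
    refine ⟨y / t, ?_, by field_simp⟩
    subst hs
    simpa [ht] using h
  · refine ⟨x / s, by field_simp, ?_⟩
    field_simp
    linarith

theorem stmt3 (T1 T2 : ℝ) (hT : (T1, T2) ≠ (0, 0))
    (v : Fin 2 → (Fin 2 → ℝ) → ℝ)
    (hv : ∀ i : Fin 2, ContDiff ℝ (⊤ : ℕ∞) (v i)) :
    IsAffineKilling Set.univ
      (fun i j k => fun _ : Fin 2 → ℝ =>
        ![![![(0 : ℝ), 0], ![T1, T2]], ![![-T1, -T2], ![0, 0]]] i j k) v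
    ↔ ∃ a b c d : ℝ, ∀ p : Fin 2 → ℝ,
        v 0 p = a + c * (p 0 * T1) + d * (p 1 * T1)
        ∧ v 1 p = b + c * (p 0 * T2) + d * (p 1 * T2) := by
  have h2 (k) : ContDiff ℝ 2 (v k) := contDiff_infty.mp (hv k) 2
  rw [isAffineKilling_iff]
  constructor
  · intro h
    have hmix (k p) : pd (fun q => pd (v k) 1 q) 0 p = 0 := by
      obtain ⟨-, -, h01, h10⟩ := h k p
      rw [pd_pd_comm (h2 k) 1 0] at h10
      linarith
    have hzero (k i j p) : pd (fun q => pd (v k) j q) i p = 0 := by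
      fin_cases i <;> fin_cases j
      · exact (h k p).1
      · exact hmix k p
      · exact (pd_pd_comm (h2 k) 1 0 p).trans (hmix k p)
      · exact (h k p).2.1
    have e0 := (h 0 0).2.2.1
    have e1 := (h 1 0).2.2.1
    rw [hmix] at e0 e1
    simp at e0 e1
    obtain ⟨c, hc0, hc1⟩ := exists_mul_eq_of_mul_eq_mul hT
      (show T2 * pd (v 0) 0 0 = T1 * pd (v 1) 0 0 by linarith)
    obtain ⟨d, hd0, hd1⟩ := exists_mul_eq_of_mul_eq_mul hT
      (show T2 * pd (v 0) 1 0 = T1 * pd (v 1) 1 0 by linarith)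
    refine ⟨v 0 0, v 1 0, c, d, fun p => ⟨?_, ?_⟩⟩
    · rw [eq_affine_of_pd_pd_eq_zero (h2 0) (hzero 0) p, hc0, hd0]
      ring
    · rw [eq_affine_of_pd_pd_eq_zero (h2 1) (hzero 1) p, hc1, hd1]
      ring
  · rintro ⟨a, b, c, d, h⟩
    have h0 : v 0 = fun p => a + c * T1 * p 0 + d * T1 * p 1 := by
      funext p
      rw [(h p).1]
      ring
    have h1 : v 1 = fun p => b + c * T2 * p 0 + d * T2 * p 1 := by
      funext p
      rw [(h p).2]
      ring
    intro k p
    fin_cases k <;> simp [h0, h1, pd_affine, pd_const] <;> constructor <;> ring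
end

section
/- Consider on the half-plane U = {(x¹,x²) ∈ ℝ² : x¹ > 0} the torsion-free Type B connection with Christoffel symbols Γ_{11}¹ = −1/x¹, Γ_{12}² = Γ_{21}² = −1/x¹, Γ_{22}¹ = −1/x¹, and all other Γ_{ij}^k = 0 (the model N₃³(0), the Lorentzian hyperbolic plane). Then a smooth vector field X on U is an affine Killing vector field for this connection if and only if X lies in the ℝ-linear span of the three vector fields (x¹, x²), (0,1), and (2x¹x², (x²)² + (x¹)²). -/
open Real

/-! ### Partial derivatives -/

theorem pd_eq_of_hasFDerivAt {f : (Fin 2 → ℝ) → ℝ} {f' : (Fin 2 → ℝ) →L[ℝ] ℝ} {p : Fin 2 → ℝ}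
    (h : HasFDerivAt f f' p) (i : Fin 2) : pd f i p = f' (Pi.single i 1) := by
  rw [pd, h.fderiv]

theorem pd_congr_of_eqOn {U : Set (Fin 2 → ℝ)} (hU : IsOpen U) {f g : (Fin 2 → ℝ) → ℝ}
    (h : Set.EqOn f g U) (i : Fin 2) {p : Fin 2 → ℝ} (hp : p ∈ U) : pd f i p = pd g i p := by
  rw [pd, pd, (h.eventuallyEq_of_mem (hU.mem_nhds hp)).fderiv_eq]

theorem pd_coord (j i : Fin 2) (p : Fin 2 → ℝ) :
    pd (fun q => q j) i p = if j = i then 1 else 0 := by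
  rw [pd_eq_of_hasFDerivAt (hasFDerivAt_apply j p)]
  simp [Pi.single_apply]

section Algebra

variable {f g : (Fin 2 → ℝ) → ℝ} {p : Fin 2 → ℝ}

theorem pd_add (hf : DifferentiableAt ℝ f p) (hg : DifferentiableAt ℝ g p) (i : Fin 2) :
    pd (fun q => f q + g q) i p = pd f i p + pd g i p := by
  simp [pd, fderiv_fun_add hf hg]

theorem pd_sub (hf : DifferentiableAt ℝ f p) (hg : DifferentiableAt ℝ g p) (i : Fin 2) :
    pd (fun q => f q - g q) i p = pd f i p - pd g i p := by
  simp [pd, fderiv_fun_sub hf hg]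

theorem pd_mul (hf : DifferentiableAt ℝ f p) (hg : DifferentiableAt ℝ g p) (i : Fin 2) :
    pd (fun q => f q * g q) i p = f p * pd g i p + g p * pd f i p := by
  simp [pd, fderiv_fun_mul hf hg]

theorem pd_pow_two (hf : DifferentiableAt ℝ f p) (i : Fin 2) :
    pd (fun q => f q ^ 2) i p = 2 * f p * pd f i p := by
  simp only [pow_two, pd_mul hf hf]
  ring

theorem differentiableAt_div (hf : DifferentiableAt ℝ f p) (hg : DifferentiableAt ℝ g p)
    (h0 : g p ≠ 0) : DifferentiableAt ℝ (fun q => f q / g q) p := by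
  simpa only [div_eq_mul_inv] using hf.fun_mul (hg.fun_inv h0)

theorem pd_div (hf : DifferentiableAt ℝ f p) (hg : DifferentiableAt ℝ g p) (h0 : g p ≠ 0)
    (i : Fin 2) :
    pd (fun q => f q / g q) i p = (pd f i p * g p - f p * pd g i p) / g p ^ 2 := by
  have hmul : pd (fun q => f q / g q * g q) i p = pd f i p := by
    have : (fun q => f q / g q * g q) =ᶠ[nhds p] f := by
      filter_upwards [hg.continuousAt.eventually_ne h0] with q hq
      exact div_mul_cancel₀ _ hq
    rw [pd, pd, this.fderiv_eq]
  rw [pd_mul (differentiableAt_div hf hg h0) hg] at hmul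
  field_simp at hmul ⊢
  linarith

end Algebra

theorem ContDiffOn.contDiffOn_pd {U : Set (Fin 2 → ℝ)} (hU : IsOpen U) {f : (Fin 2 → ℝ) → ℝ}
    (hf : ContDiffOn ℝ (⊤ : ℕ∞) f U) (i : Fin 2) : ContDiffOn ℝ (⊤ : ℕ∞) (pd f i) U :=
  (hf.fderiv_of_isOpen hU (by simp)).clm_apply contDiffOn_const

theorem exists_eqOn_const_of_pd_eq_zero {U : Set (Fin 2 → ℝ)} (hU : IsOpen U)
    (hc : IsPreconnected U) {f : (Fin 2 → ℝ) → ℝ} (hf : DifferentiableOn ℝ f U)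
    (h : ∀ i, ∀ p ∈ U, pd f i p = 0) : ∃ a, ∀ p ∈ U, f p = a := by
  refine hU.exists_is_const_of_fderiv_eq_zero hc hf fun p hp => ?_
  ext w
  have hw : w = ∑ i, w i • (Pi.single i 1 : Fin 2 → ℝ) := pi_eq_sum_univ' w
  rw [hw, map_sum]
  refine Finset.sum_eq_zero fun i _ => ?_
  rw [map_smul, show fderiv ℝ f p (Pi.single i 1) = 0 from h i p hp, smul_zero]

/-! ### The half-plane -/

theorem isOpen_halfPlane : IsOpen {p : Fin 2 → ℝ | 0 < p 0} :=
  isOpen_lt continuous_const (continuous_apply 0)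

theorem convex_halfPlane : Convex ℝ {p : Fin 2 → ℝ | 0 < p 0} :=
  convex_halfSpace_gt (LinearMap.proj (R := ℝ) (φ := fun _ : Fin 2 => ℝ) 0).isLinear 0

/-- A function with vanishing `x¹`-derivative on the half-plane depends only on `x²`. -/
theorem eq_of_pd_zero_eq_zero {f : (Fin 2 → ℝ) → ℝ}
    (hf : DifferentiableOn ℝ f {p | 0 < p 0}) (h : ∀ p : Fin 2 → ℝ, 0 < p 0 → pd f 0 p = 0)
    {s t : ℝ} (hs : 0 < s) (ht : 0 < t) (y : ℝ) : f ![s, y] = f ![t, y] := by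
  have hline : ∀ r ∈ Set.Ioi (0 : ℝ), HasDerivAt (fun r => f ![r, y]) 0 r := by
    intro r hr
    have hd : HasDerivAt (fun r : ℝ => (![r, y] : Fin 2 → ℝ)) (Pi.single 0 1) r := by
      rw [hasDerivAt_pi]
      intro i
      fin_cases i
      · simpa using hasDerivAt_id' r
      · simpa using hasDerivAt_const r y
    have hfd := (hf.differentiableAt
      (isOpen_halfPlane.mem_nhds (show 0 < ![r, y] 0 from hr))).hasFDerivAt
    have := hfd.comp_hasDerivAt r hd
    rwa [show fderiv ℝ f ![r, y] (Pi.single 0 1) = 0 from h _ hr] at this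
  exact isOpen_Ioi.is_const_of_deriv_eq_zero (convex_Ioi 0).isPreconnected
    (fun r hr => (hline r hr).differentiableAt.differentiableWithinAt)
    (fun r hr => (hline r hr).deriv) hs ht

/-- If the `x¹`-derivative vanishes on the half-plane, the `x²`-derivative depends only on `x²`. -/
theorem pd_one_eq_of_pd_zero_eq_zero {f : (Fin 2 → ℝ) → ℝ}
    (hf : DifferentiableOn ℝ f {p | 0 < p 0}) (h : ∀ p : Fin 2 → ℝ, 0 < p 0 → pd f 0 p = 0)
    {s t : ℝ} (hs : 0 < s) (ht : 0 < t) (y : ℝ) : pd f 1 ![s, y] = pd f 1 ![t, y] := by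
  have hline : ∀ r : ℝ, 0 < r → HasDerivAt (fun y => f ![r, y]) (pd f 1 ![r, y]) y := by
    intro r hr
    have hd : HasDerivAt (fun y : ℝ => (![r, y] : Fin 2 → ℝ)) (Pi.single 1 1) y := by
      rw [hasDerivAt_pi]
      intro i
      fin_cases i
      · simpa using hasDerivAt_const y r
      · simpa using hasDerivAt_id' y
    exact (hf.differentiableAt
      (isOpen_halfPlane.mem_nhds (show 0 < ![r, y] 0 from hr))).hasFDerivAt.comp_hasDerivAt y hd
  refine (hline s hs).unique ?_
  simpa only [funext fun z => eq_of_pd_zero_eq_zero hf h hs ht z] using hline t ht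

/-! ### Affine Killing fields -/

theorem killingOp_typeB (A : Fin 2 → Fin 2 → Fin 2 → ℝ) (v : Fin 2 → (Fin 2 → ℝ) → ℝ)
    (i j k : Fin 2) {p : Fin 2 → ℝ} (hp : p 0 ≠ 0) :
    killingOp (fun i j k p => A i j k / p 0) v i j k p =
      pd (pd (v k) j) i p - A i j k * v 0 p / p 0 ^ 2
        + (∑ l, (A i l k * pd (v l) j p + A l j k * pd (v l) i p - A i j l * pd (v k) l p))
          / p 0 := by
  have hΓ : ∀ l, pd (fun q : Fin 2 → ℝ => A i j k / q 0) l p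
      = if l = 0 then -A i j k / p 0 ^ 2 else 0 := by
    intro l
    rw [pd_div (by fun_prop) (by fun_prop) hp, pd_const, pd_coord]
    fin_cases l <;> simp
  simp only [killingOp, hΓ, Fin.sum_univ_two]
  simp
  ring

/-- The affine Killing equations of the Lorentzian hyperbolic plane. -/
theorem isAffineKilling_lorentz_iff (v : Fin 2 → (Fin 2 → ℝ) → ℝ) :
    IsAffineKilling {p : Fin 2 → ℝ | 0 < p 0}
      (fun i j k => fun p : Fin 2 → ℝ =>
        ![![![(-1 : ℝ), 0], ![0, -1]], ![![0, -1], ![-1, 0]]] i j k / p 0) v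
    ↔ ∀ p : Fin 2 → ℝ, 0 < p 0 →
      pd (pd (v 0) 0) 0 p = pd (v 0) 0 p / p 0 - v 0 p / p 0 ^ 2
      ∧ pd (pd (v 1) 0) 0 p = pd (v 1) 0 p / p 0
      ∧ pd (pd (v 0) 1) 0 p = pd (v 1) 0 p / p 0
      ∧ pd (pd (v 1) 1) 0 p = pd (v 0) 0 p / p 0 - v 0 p / p 0 ^ 2
      ∧ pd (pd (v 0) 0) 1 p = pd (v 1) 0 p / p 0
      ∧ pd (pd (v 1) 0) 1 p = pd (v 0) 0 p / p 0 - v 0 p / p 0 ^ 2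
      ∧ pd (pd (v 0) 1) 1 p = (2 * pd (v 1) 1 p - pd (v 0) 0 p) / p 0 - v 0 p / p 0 ^ 2
      ∧ pd (pd (v 1) 1) 1 p = (2 * pd (v 0) 1 p - pd (v 1) 0 p) / p 0 := by
  constructor
  · intro h p hp
    have h' := fun i j k => (killingOp_typeB _ v i j k hp.ne').symm.trans (h i j k p hp)
    refine ⟨?_, ?_, ?_, ?_, ?_, ?_, ?_, ?_⟩
    · have := h' 0 0 0; simp [Fin.sum_univ_two] at this; linear_combination this
    · have := h' 0 0 1; simp [Fin.sum_univ_two] at this; linear_combination this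
    · have := h' 0 1 0; simp [Fin.sum_univ_two] at this; linear_combination this
    · have := h' 0 1 1; simp [Fin.sum_univ_two] at this; linear_combination this
    · have := h' 1 0 0; simp [Fin.sum_univ_two] at this; linear_combination this
    · have := h' 1 0 1; simp [Fin.sum_univ_two] at this; linear_combination this
    · have := h' 1 1 0; simp [Fin.sum_univ_two] at this; linear_combination this
    · have := h' 1 1 1; simp [Fin.sum_univ_two] at this; linear_combination this
  · intro h i j k p hp
    obtain ⟨h1, h2, h3, h4, h5, h6, h7, h8⟩ := h p hp
    refine (killingOp_typeB _ v i j k (ne_of_gt hp)).trans ?_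
    fin_cases i <;> fin_cases j <;> fin_cases k <;>
      simp [Fin.sum_univ_two, h1, h2, h3, h4, h5, h6, h7, h8] <;> ring

/-- Vector fields in the span of `(x¹, x²)`, `(0, 1)` and `(2x¹x², (x²)² + (x¹)²)` satisfy the
affine Killing equations. -/
theorem isAffineKilling_lorentz_of_eqOn {v : Fin 2 → (Fin 2 → ℝ) → ℝ} {a b c : ℝ}
    (h0 : ∀ p : Fin 2 → ℝ, 0 < p 0 → v 0 p = a * p 0 + c * (2 * p 0 * p 1))
    (h1 : ∀ p : Fin 2 → ℝ, 0 < p 0 → v 1 p = a * p 1 + b + c * ((p 1) ^ 2 + (p 0) ^ 2)) :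
    IsAffineKilling {p : Fin 2 → ℝ | 0 < p 0}
      (fun i j k => fun p : Fin 2 → ℝ =>
        ![![![(-1 : ℝ), 0], ![0, -1]], ![![0, -1], ![-1, 0]]] i j k / p 0) v := by
  have hu : ∀ (i : Fin 2) (p : Fin 2 → ℝ), 0 < p 0 →
      pd (v 0) i p = ![a + 2 * c * p 1, 2 * c * p 0] i := by
    intro i p hp
    rw [pd_congr_of_eqOn isOpen_halfPlane h0 i hp]
    simp (disch := fun_prop) only [pd_add, pd_mul, pd_const, pd_coord]
    fin_cases i <;> simp <;> ring
  have hw : ∀ (i : Fin 2) (p : Fin 2 → ℝ), 0 < p 0 →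
      pd (v 1) i p = ![2 * c * p 0, a + 2 * c * p 1] i := by
    intro i p hp
    rw [pd_congr_of_eqOn isOpen_halfPlane h1 i hp]
    simp (disch := fun_prop) only [pd_add, pd_mul, pd_pow_two, pd_const, pd_coord]
    fin_cases i <;> simp <;> ring
  rw [isAffineKilling_lorentz_iff]
  intro p hp
  have h : ∀ i j, pd (pd (v 0) j) i p = ![![0, 2 * c], ![2 * c, 0]] i j
      ∧ pd (pd (v 1) j) i p = ![![2 * c, 0], ![0, 2 * c]] i j := by
    intro i j
    rw [pd_congr_of_eqOn isOpen_halfPlane (hu j) i hp,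
      pd_congr_of_eqOn isOpen_halfPlane (hw j) i hp]
    fin_cases j <;> simp (disch := fun_prop) [pd_add, pd_mul, pd_const, pd_coord] <;>
      fin_cases i <;> simp
  simp only [(h _ _).1, (h _ _).2, hu _ p hp, hw _ p hp, h0 p hp]
  have := hp.ne'
  refine ⟨?_, ?_, ?_, ?_, ?_, ?_, ?_, ?_⟩ <;> simp <;> field_simp <;> ring

theorem exists_of_isAffineKilling_lorentz {v : Fin 2 → (Fin 2 → ℝ) → ℝ}
    (hv : ∀ i : Fin 2, ContDiffOn ℝ (⊤ : ℕ∞) (v i) {p : Fin 2 → ℝ | 0 < p 0})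
    (hK : IsAffineKilling {p : Fin 2 → ℝ | 0 < p 0}
      (fun i j k => fun p : Fin 2 → ℝ =>
        ![![![(-1 : ℝ), 0], ![0, -1]], ![![0, -1], ![-1, 0]]] i j k / p 0) v) :
    ∃ a b c : ℝ, ∀ p : Fin 2 → ℝ, 0 < p 0 →
        v 0 p = a * p 0 + c * (2 * p 0 * p 1)
        ∧ v 1 p = a * p 1 + b + c * ((p 1) ^ 2 + (p 0) ^ 2) := by
  rw [isAffineKilling_lorentz_iff] at hK
  have hconn := convex_halfPlane.isPreconnected
  have dv : ∀ k (p : Fin 2 → ℝ), 0 < p 0 → DifferentiableAt ℝ (v k) p := fun k p hp =>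
    ((hv k).contDiffAt (isOpen_halfPlane.mem_nhds hp)).differentiableAt (by simp)
  have dpd : ∀ k i (p : Fin 2 → ℝ), 0 < p 0 → DifferentiableAt ℝ (pd (v k) i) p :=
    fun k i p hp => (((hv k).contDiffOn_pd isOpen_halfPlane i).contDiffAt
      (isOpen_halfPlane.mem_nhds hp)).differentiableAt (by simp)
  have dx : ∀ (j : Fin 2) (p : Fin 2 → ℝ), DifferentiableAt ℝ (fun q : Fin 2 → ℝ => q j) p :=
    fun j p => by fun_prop
  -- `P = ∂₁v² / x¹` and `Q = ∂₁v¹ - v¹ / x¹` do not depend on `x¹`, and `∂₂P = Q / (x¹)²`.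
  set P : (Fin 2 → ℝ) → ℝ := fun p => pd (v 1) 0 p / p 0 with hP
  set Q : (Fin 2 → ℝ) → ℝ := fun p => pd (v 0) 0 p - v 0 p / p 0 with hQ
  have dP : DifferentiableOn ℝ P {p | 0 < p 0} := fun p hp =>
    (differentiableAt_div (dpd 1 0 p hp) (dx 0 p) (ne_of_gt hp)).differentiableWithinAt
  have dQ : DifferentiableOn ℝ Q {p | 0 < p 0} := fun p hp =>
    ((dpd 0 0 p hp).fun_sub (differentiableAt_div (dv 0 p hp) (dx 0 p) (ne_of_gt hp))).differentiableWithinAt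
  have hP0 : ∀ p : Fin 2 → ℝ, 0 < p 0 → pd P 0 p = 0 := by
    intro p hp
    have := hp.ne'
    rw [hP, pd_div (dpd 1 0 p hp) (dx 0 p) hp.ne', (hK p hp).2.1, pd_coord]
    simp
    field_simp
    simp
  have hQ0 : ∀ p : Fin 2 → ℝ, 0 < p 0 → pd Q 0 p = 0 := by
    intro p hp
    have := hp.ne'
    rw [hQ, pd_sub (dpd 0 0 p hp) (differentiableAt_div (dv 0 p hp) (dx 0 p) hp.ne'),
      pd_div (dv 0 p hp) (dx 0 p) hp.ne', (hK p hp).1, pd_coord]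
    simp
    field_simp
    ring
  have hP1 : ∀ p : Fin 2 → ℝ, 0 < p 0 → pd P 1 p = Q p / p 0 ^ 2 := by
    intro p hp
    have := hp.ne'
    rw [hP, pd_div (dpd 1 0 p hp) (dx 0 p) hp.ne', (hK p hp).2.2.2.2.2.1, pd_coord]
    simp [hQ]
    field_simp
  have hQz : ∀ p : Fin 2 → ℝ, 0 < p 0 → Q p = 0 := by
    intro p hp
    have hp2 : 0 < 2 * p 0 := by positivity
    have e1 := pd_one_eq_of_pd_zero_eq_zero dP hP0 hp hp2 (p 1)
    have e2 := eq_of_pd_zero_eq_zero dQ hQ0 hp hp2 (p 1)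
    rw [hP1 ![p 0, p 1] hp, hP1 ![2 * p 0, p 1] hp2, ← e2, show ![p 0, p 1] = p by ext i; fin_cases i <;> rfl] at e1
    have := hp.ne'
    simp at e1
    field_simp at e1
    linarith
  obtain ⟨m, hm⟩ := exists_eqOn_const_of_pd_eq_zero isOpen_halfPlane hconn dP (by
    intro i p hp
    fin_cases i
    · exact hP0 p hp
    · simp [hP1 p hp, hQz p hp])
  have hux : ∀ p : Fin 2 → ℝ, 0 < p 0 → pd (v 0) 0 p = v 0 p / p 0 := fun p hp =>
    sub_eq_zero.1 (hQz p hp)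
  obtain ⟨a, ha⟩ := exists_eqOn_const_of_pd_eq_zero isOpen_halfPlane hconn
    (f := fun p => v 0 p / p 0 - m * p 1)
    (fun p hp => ((differentiableAt_div (dv 0 p hp) (dx 0 p) (ne_of_gt hp)).fun_sub
      ((dx 1 p).const_mul m)).differentiableWithinAt) (by
    intro i p (hp : 0 < p 0)
    have := hp.ne'
    have hmix := (hK p hp).2.2.2.2.1
    rw [pd_congr_of_eqOn isOpen_halfPlane hux 1 hp, pd_div (dv 0 p hp) (dx 0 p) hp.ne',
      show pd (v 1) 0 p / p 0 = m from hm p hp, pd_coord] at hmix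
    rw [pd_sub (differentiableAt_div (dv 0 p hp) (dx 0 p) hp.ne') ((dx 1 p).const_mul m),
      pd_div (dv 0 p hp) (dx 0 p) hp.ne', pd_mul (by fun_prop) (dx 1 p), pd_const]
    fin_cases i
    · simp [pd_coord, hux p hp]
      field_simp
      simp
    · simp [pd_coord] at hmix ⊢
      linarith)
  have hu : ∀ p : Fin 2 → ℝ, 0 < p 0 → v 0 p = (m * p 1 + a) * p 0 := by
    intro p hp
    have := ha p hp
    have := hp.ne'
    field_simp at *
    linarith
  have hwx : ∀ p : Fin 2 → ℝ, 0 < p 0 → pd (v 1) 0 p = m * p 0 := fun p hp =>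
    (div_eq_iff hp.ne').1 (hm p hp)
  have huy : ∀ p : Fin 2 → ℝ, 0 < p 0 → pd (v 0) 1 p = m * p 0 := by
    intro p hp
    rw [pd_congr_of_eqOn isOpen_halfPlane hu 1 hp]
    simp (disch := fun_prop) only [pd_add, pd_mul, pd_const, pd_coord]
    simp
    ring
  have hwy : ∀ p : Fin 2 → ℝ, 0 < p 0 → pd (v 1) 1 p = m * p 1 + a := by
    intro p hp
    have h := (hK p hp).2.2.2.2.2.2.1
    rw [pd_congr_of_eqOn isOpen_halfPlane huy 1 hp, hux p hp, hu p hp,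
      pd_mul (by fun_prop) (dx 0 p), pd_const, pd_coord] at h
    have := hp.ne'
    simp at h
    field_simp at h
    linarith
  obtain ⟨b, hb⟩ := exists_eqOn_const_of_pd_eq_zero isOpen_halfPlane hconn
    (f := fun p => v 1 p - (a * p 1 + m / 2 * (p 1 ^ 2 + p 0 ^ 2)))
    (fun p hp => ((dv 1 p hp).fun_sub (by fun_prop)).differentiableWithinAt) (by
    intro i p (hp : 0 < p 0)
    rw [pd_sub (dv 1 p hp) (by fun_prop)]
    simp (disch := fun_prop) only [pd_add, pd_mul, pd_pow_two, pd_const, pd_coord]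
    fin_cases i
    · simp [hwx p hp]
      ring
    · simp [hwy p hp]
      ring)
  refine ⟨a, b, m / 2, fun p hp => ⟨?_, ?_⟩⟩
  · rw [hu p hp]
    ring
  · linear_combination hb p hp

theorem stmt17
    (v : Fin 2 → (Fin 2 → ℝ) → ℝ)
    (hv : ∀ i : Fin 2, ContDiffOn ℝ (⊤ : ℕ∞) (v i) {p : Fin 2 → ℝ | 0 < p 0}) :
    IsAffineKilling {p : Fin 2 → ℝ | 0 < p 0}
      (fun i j k => fun p : Fin 2 → ℝ =>
        ![![![(-1 : ℝ), 0], ![0, -1]], ![![0, -1], ![-1, 0]]] i j k / p 0) v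
    ↔ ∃ a b c : ℝ, ∀ p ∈ {p : Fin 2 → ℝ | 0 < p 0},
        v 0 p = a * p 0 + c * (2 * p 0 * p 1)
        ∧ v 1 p = a * p 1 + b + c * ((p 1) ^ 2 + (p 0) ^ 2) := by
  refine ⟨exists_of_isAffineKilling_lorentz hv, ?_⟩
  rintro ⟨a, b, c, h⟩
  exact isAffineKilling_lorentz_of_eqOn (fun p hp => (h p hp).1) (fun p hp => (h p hp).2)
end
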